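/- Let E be a finite-dimensional spectral COSEA, let Ω̂(E)=Ω(E)∪{0} (0 the zero functional), and for a∈E let γ_a:Ω̂(E)→Ω̂(E) be the conditional probability map. Then: (i) for a∈S_1(E), â is the unique nonzero fixed point of γ_a, i.e. γ_a(ω)=ω with ω≠0 implies ω=â; (ii) if a⊥b, c∘a=a∘c and c∘b=b∘c, then for all ω∈Ω(E), ω(a⊕b)·γ_{a⊕b}(ω)(c)=ω(a)·γ_a(ω)(c)+ω(b)·γ_b(ω)(c); (iii) if a∘b=b∘a, then for all ω∈Ω̂(E), ω(a')·γ_{a'}(ω)(b)=ω(b)−ω(a)·γ_a(ω)(b); (iv) for all ω∈Ω̂(E) and a,b,c∈E, ω(a∘b)·γ_{a∘b}(ω)(c)=ω((a∘b)∘c) and ω(a∘b)·(γ_b(γ_a(ω)))(c)=ω(a∘(b∘c)). -/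

import Mathlib

set_option linter.unusedVariables false

universe u v

theorem prod_eq' {α β : Type*} {p q : α × β} (h1 : p.1 = q.1) (h2 : p.2 = q.2) : p = q :=
  Prod.ext_iff.mpr ⟨h1, h2⟩

/-- A convex sequential effect algebra (COSEA).  The partial sum `⊕` is modelled by a
total operation `oplus` together with a definedness predicate `perp`; all axioms only
constrain `oplus` on pairs satisfying `perp`.  The scalar action is modelled by a total
map `smul : ℝ → E → E`, with axioms imposed for scalars in `[0,1]`. -/
structure COSEA (E : Type u) where
  zero : E
  one : E
  perp : E → E → Prop
  oplus : E → E → E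
  compl : E → E
  smul : ℝ → E → E
  seq : E → E → E
  -- effect algebra axioms
  perp_comm : ∀ a b, perp a b → perp b a
  oplus_comm : ∀ a b, perp a b → oplus a b = oplus b a
  perp_assoc_right : ∀ a b c, perp a b → perp (oplus a b) c → perp b c
  perp_assoc_left : ∀ a b c, perp a b → perp (oplus a b) c → perp a (oplus b c)
  oplus_assoc : ∀ a b c, perp a b → perp (oplus a b) c →
    oplus a (oplus b c) = oplus (oplus a b) c
  perp_compl : ∀ a, perp a (compl a)
  oplus_compl : ∀ a, oplus a (compl a) = one
  compl_unique : ∀ a b, perp a b → oplus a b = one → b = compl a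
  perp_one : ∀ a, perp a one → a = zero
  -- convexity axioms
  smul_smul : ∀ α β a, 0 ≤ α → α ≤ 1 → 0 ≤ β → β ≤ 1 →
    smul α (smul β a) = smul (α * β) a
  perp_smul_self : ∀ α β a, 0 ≤ α → 0 ≤ β → α + β ≤ 1 → perp (smul α a) (smul β a)
  add_smul : ∀ α β a, 0 ≤ α → 0 ≤ β → α + β ≤ 1 →
    smul (α + β) a = oplus (smul α a) (smul β a)
  perp_smul : ∀ lam a b, 0 ≤ lam → lam ≤ 1 → perp a b → perp (smul lam a) (smul lam b)
  smul_oplus : ∀ lam a b, 0 ≤ lam → lam ≤ 1 → perp a b →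
    smul lam (oplus a b) = oplus (smul lam a) (smul lam b)
  one_smul : ∀ a, smul 1 a = a
  -- sequential product axioms
  seq_perp : ∀ a b c, perp b c → perp (seq a b) (seq a c)
  seq_oplus : ∀ a b c, perp b c → seq a (oplus b c) = oplus (seq a b) (seq a c)
  one_seq : ∀ a, seq one a = a
  seq_eq_zero_comm : ∀ a b, seq a b = zero → seq b a = seq a b
  comm_compl : ∀ a b, seq a b = seq b a → seq a (compl b) = seq (compl b) a
  comm_assoc : ∀ a b c, seq a b = seq b a → seq a (seq b c) = seq (seq a b) c
  comm_seq : ∀ a b c, seq c a = seq a c → seq c b = seq b c →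
    seq c (seq a b) = seq (seq a b) c
  comm_oplus : ∀ a b c, seq c a = seq a c → seq c b = seq b c → perp a b →
    seq c (oplus a b) = seq (oplus a b) c
  smul_seq : ∀ lam a b, 0 ≤ lam → lam ≤ 1 → seq (smul lam a) b = smul lam (seq a b)
  seq_smul : ∀ lam a b, 0 ≤ lam → lam ≤ 1 → seq a (smul lam b) = smul lam (seq a b)

/-- `SumList C l s` : the orthogonal sum of the list `l` is defined and equals `s`. -/
inductive COSEA.SumList {E : Type u} (C : COSEA E) : List E → E → Prop
  | nil : COSEA.SumList C [] C.zero
  | cons {a : E} {l : List E} {s : E} :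
      COSEA.SumList C l s → C.perp a s → COSEA.SumList C (a :: l) (C.oplus a s)

namespace COSEA

variable {E : Type u}

/-- `a ≤ b` in the effect-algebra order. -/
def le (C : COSEA E) (a b : E) : Prop := ∃ c, C.perp a c ∧ C.oplus a c = b

/-- `a` is sharp: the greatest lower bound of `a` and `a'` is `0`,
i.e. every common lower bound of `a` and `a'` lies below `0`. -/
def IsSharp (C : COSEA E) (a : E) : Prop :=
  ∀ c, C.le c a → C.le c (C.compl a) → C.le c C.zero

/-- `a` is a one-dimensional (atomic) sharp element. -/
def IsOneDim (C : COSEA E) (a : E) : Prop :=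
  C.IsSharp a ∧ a ≠ C.zero ∧
    ∀ b, C.le b a → ∃ lam : ℝ, 0 ≤ lam ∧ lam ≤ 1 ∧ b = C.smul lam a

/-- A state on a COSEA. -/
def IsState (C : COSEA E) (ω : E → ℝ) : Prop :=
  (∀ a, 0 ≤ ω a ∧ ω a ≤ 1) ∧ ω C.one = 1 ∧
    ∀ a b, C.perp a b → ω (C.oplus a b) = ω a + ω b

/-- A context presented as an injective finite enumeration of one-dimensional
elements summing to `1`. -/
def IsContextFun (C : COSEA E) {n : ℕ} (a : Fin n → E) : Prop :=
  Function.Injective a ∧ (∀ i, C.IsOneDim (a i)) ∧ C.SumList (List.ofFn a) C.one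

/-- A context as a set of effects. -/
def IsContext (C : COSEA E) (A : Set E) : Prop :=
  ∃ (n : ℕ) (a : Fin n → E), C.IsContextFun a ∧ Set.range a = A

/-- `E` is finite-dimensional: there is no infinite sequence of one-dimensional
elements all of whose initial partial orthogonal sums are defined. -/
def FinDim (C : COSEA E) : Prop :=
  ¬ ∃ f : ℕ → E, (∀ i, C.IsOneDim (f i)) ∧
      ∀ n : ℕ, ∃ s, C.SumList ((List.range n).map f) s

/-- `E` is state-unique. -/
def StateUnique (C : COSEA E) : Prop :=
  ∀ a, C.IsOneDim a → ∃! ω : E → ℝ, C.IsState ω ∧ ω a = 1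

/-- `E` is symmetric : `â(b) = b̂(a)` for all one-dimensional `a, b`. -/
def Symm (C : COSEA E) : Prop :=
  ∀ a b ω ρ, C.IsOneDim a → C.IsOneDim b → C.IsState ω → C.IsState ρ →
    ω a = 1 → ρ b = 1 → ω b = ρ a

/-- `b = λ₁ a₁ ⊕ ⋯ ⊕ λₙ aₙ` with all `λ i ∈ [0,1]`. -/
def SpanRep (C : COSEA E) {n : ℕ} (a : Fin n → E) (lam : Fin n → ℝ) (b : E) : Prop :=
  (∀ i, 0 ≤ lam i ∧ lam i ≤ 1) ∧
    C.SumList (List.ofFn fun i => C.smul (lam i) (a i)) b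

/-- `b ∈ E(A)` : `b` has a representation over the context `A`. -/
def InSpan (C : COSEA E) (A : Set E) (b : E) : Prop :=
  ∃ (n : ℕ) (a : Fin n → E) (lam : Fin n → ℝ),
    C.IsContextFun a ∧ Set.range a = A ∧ C.SpanRep a lam b

/-- `E` is spectral. -/
def Spectral (C : COSEA E) : Prop :=
  C.StateUnique ∧ ∀ b, ∃ A, C.IsContext A ∧ C.InSpan A b

/-- The commutant of a subset. -/
def commutant (C : COSEA E) (F : Set E) : Set E :=
  {b | ∀ a ∈ F, C.seq b a = C.seq a b}

/-- The center `E' = {b : b ∘ a = a ∘ b for all a}`. -/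
def center (C : COSEA E) : Set E := C.commutant Set.univ

/-- `E` is a factor: the center consists of the effects `λ 1`, `λ ∈ [0,1]`. -/
def IsFactor (C : COSEA E) : Prop :=
  C.center = {b | ∃ lam : ℝ, 0 ≤ lam ∧ lam ≤ 1 ∧ b = C.smul lam C.one}

/-- Sub-COSEA. -/
def IsSubCOSEA (C : COSEA E) (F : Set E) : Prop :=
  C.zero ∈ F ∧ C.one ∈ F ∧ (∀ a ∈ F, C.compl a ∈ F) ∧
    (∀ lam : ℝ, 0 ≤ lam → lam ≤ 1 → ∀ a ∈ F, C.smul lam a ∈ F) ∧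
    (∀ a ∈ F, ∀ b ∈ F, C.perp a b → C.oplus a b ∈ F) ∧
    (∀ a ∈ F, ∀ b ∈ F, C.seq a b ∈ F)

/-- `a` is a minimal sharp element of `F`. -/
def MinSharp (C : COSEA E) (F : Set E) (a : E) : Prop :=
  a ∈ F ∧ C.IsSharp a ∧ a ≠ C.zero ∧
    ∀ b ∈ F, C.IsSharp b → b ≠ C.zero → C.le b a → b = a

/-- COSEA isomorphism. -/
def IsIso {F : Type u} (C : COSEA E) (D : COSEA F) (φ : E → F) : Prop :=
  Function.Bijective φ ∧ φ C.one = D.one ∧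
    (∀ a b, C.perp a b ↔ D.perp (φ a) (φ b)) ∧
    (∀ a b, C.perp a b → φ (C.oplus a b) = D.oplus (φ a) (φ b)) ∧
    (∀ lam : ℝ, 0 ≤ lam → lam ≤ 1 → ∀ a, φ (C.smul lam a) = D.smul lam (φ a)) ∧
    (∀ a b, φ (C.seq a b) = D.seq (φ a) (φ b))

/-- `lam` is an eigenvalue of `b` : `lam = â(b)` for some eigeneffect `a` of `b`. -/
def IsEigenvalue (C : COSEA E) (b : E) (lam : ℝ) : Prop :=
  ∃ (a : E) (ω : E → ℝ), C.IsOneDim a ∧ C.seq a b = C.seq b a ∧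
    C.IsState ω ∧ ω a = 1 ∧ lam = ω b

/-- The spectrum of `b`. -/
def spectrum (C : COSEA E) (b : E) : Set ℝ := {lam | C.IsEigenvalue b lam}

/-- `c = ⌈a⌉` : `c` is the least sharp element dominating `a`. -/
def IsCeil (C : COSEA E) (a c : E) : Prop :=
  C.IsSharp c ∧ C.le a c ∧ ∀ d, C.IsSharp d → C.le a d → C.le c d

/-- `b` is a pseudo-inverse of `a` with scalar `lam` :
`⌈b⌉ = ⌈a⌉`, `‖b‖ = 1` and `a ∘ b = b ∘ a = lam ⌈a⌉`. -/
def IsPseudoInvWith (C : COSEA E) (a b : E) (lam : ℝ) : Prop :=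
  (∃ ca, C.IsCeil a ca ∧ C.IsCeil b ca ∧
    C.seq a b = C.smul lam ca ∧ C.seq b a = C.smul lam ca) ∧
  IsGreatest (C.spectrum b) 1 ∧ 0 ≤ lam ∧ lam ≤ 1

/-- The conditional probability map `γ_a` (zero functionals are sent to `0`). -/
noncomputable def condProb (C : COSEA E) (a : E) (ω : E → ℝ) : E → ℝ :=
  fun c => if ω a = 0 then 0 else ω (C.seq a c) / ω a

/-- Membership in `Ω̂(E) = Ω(E) ∪ {0}`. -/
def InOmegaHat (C : COSEA E) (ω : E → ℝ) : Prop :=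
  C.IsState ω ∨ ω = fun _ => 0

/-- Direct sum of two COSEAs, with all operations componentwise. -/
def prod {E F : Type u} (C : COSEA E) (D : COSEA F) : COSEA (E × F) where
  zero := (C.zero, D.zero)
  one := (C.one, D.one)
  perp a b := C.perp a.1 b.1 ∧ D.perp a.2 b.2
  oplus a b := (C.oplus a.1 b.1, D.oplus a.2 b.2)
  compl a := (C.compl a.1, D.compl a.2)
  smul lam a := (C.smul lam a.1, D.smul lam a.2)
  seq a b := (C.seq a.1 b.1, D.seq a.2 b.2)
  perp_comm := fun a b h => ⟨C.perp_comm _ _ h.1, D.perp_comm _ _ h.2⟩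
  oplus_comm := fun a b h => prod_eq' (C.oplus_comm _ _ h.1) (D.oplus_comm _ _ h.2)
  perp_assoc_right := fun a b c h1 h2 =>
    ⟨C.perp_assoc_right _ _ _ h1.1 h2.1, D.perp_assoc_right _ _ _ h1.2 h2.2⟩
  perp_assoc_left := fun a b c h1 h2 =>
    ⟨C.perp_assoc_left _ _ _ h1.1 h2.1, D.perp_assoc_left _ _ _ h1.2 h2.2⟩
  oplus_assoc := fun a b c h1 h2 =>
    prod_eq' (C.oplus_assoc _ _ _ h1.1 h2.1) (D.oplus_assoc _ _ _ h1.2 h2.2)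
  perp_compl := fun a => ⟨C.perp_compl _, D.perp_compl _⟩
  oplus_compl := fun a => prod_eq' (C.oplus_compl _) (D.oplus_compl _)
  compl_unique := fun a b h he =>
    prod_eq' (C.compl_unique _ _ h.1 (congrArg Prod.fst he))
      (D.compl_unique _ _ h.2 (congrArg Prod.snd he))
  perp_one := fun a h => prod_eq' (C.perp_one _ h.1) (D.perp_one _ h.2)
  smul_smul := fun α β a h1 h2 h3 h4 =>
    prod_eq' (C.smul_smul _ _ _ h1 h2 h3 h4) (D.smul_smul _ _ _ h1 h2 h3 h4)
  perp_smul_self := fun α β a h1 h2 h3 =>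
    ⟨C.perp_smul_self _ _ _ h1 h2 h3, D.perp_smul_self _ _ _ h1 h2 h3⟩
  add_smul := fun α β a h1 h2 h3 =>
    prod_eq' (C.add_smul _ _ _ h1 h2 h3) (D.add_smul _ _ _ h1 h2 h3)
  perp_smul := fun lam a b h1 h2 h =>
    ⟨C.perp_smul _ _ _ h1 h2 h.1, D.perp_smul _ _ _ h1 h2 h.2⟩
  smul_oplus := fun lam a b h1 h2 h =>
    prod_eq' (C.smul_oplus _ _ _ h1 h2 h.1) (D.smul_oplus _ _ _ h1 h2 h.2)
  one_smul := fun a => prod_eq' (C.one_smul _) (D.one_smul _)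
  seq_perp := fun a b c h => ⟨C.seq_perp _ _ _ h.1, D.seq_perp _ _ _ h.2⟩
  seq_oplus := fun a b c h => prod_eq' (C.seq_oplus _ _ _ h.1) (D.seq_oplus _ _ _ h.2)
  one_seq := fun a => prod_eq' (C.one_seq _) (D.one_seq _)
  seq_eq_zero_comm := fun a b h =>
    prod_eq' (C.seq_eq_zero_comm _ _ (congrArg Prod.fst h))
      (D.seq_eq_zero_comm _ _ (congrArg Prod.snd h))
  comm_compl := fun a b h =>
    prod_eq' (C.comm_compl _ _ (congrArg Prod.fst h))
      (D.comm_compl _ _ (congrArg Prod.snd h))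
  comm_assoc := fun a b c h =>
    prod_eq' (C.comm_assoc _ _ _ (congrArg Prod.fst h))
      (D.comm_assoc _ _ _ (congrArg Prod.snd h))
  comm_seq := fun a b c h1 h2 =>
    prod_eq' (C.comm_seq _ _ _ (congrArg Prod.fst h1) (congrArg Prod.fst h2))
      (D.comm_seq _ _ _ (congrArg Prod.snd h1) (congrArg Prod.snd h2))
  comm_oplus := fun a b c h1 h2 hp =>
    prod_eq' (C.comm_oplus _ _ _ (congrArg Prod.fst h1) (congrArg Prod.fst h2) hp.1)
      (D.comm_oplus _ _ _ (congrArg Prod.snd h1) (congrArg Prod.snd h2) hp.2)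
  smul_seq := fun lam a b h1 h2 =>
    prod_eq' (C.smul_seq _ _ _ h1 h2) (D.smul_seq _ _ _ h1 h2)
  seq_smul := fun lam a b h1 h2 =>
    prod_eq' (C.seq_smul _ _ _ h1 h2) (D.seq_smul _ _ _ h1 h2)

/-- Direct sum of a family of COSEAs, with all operations componentwise. -/
def pi {ι : Type v} {E : ι → Type u} (C : ∀ i, COSEA (E i)) : COSEA (∀ i, E i) where
  zero := fun i => (C i).zero
  one := fun i => (C i).one
  perp a b := ∀ i, (C i).perp (a i) (b i)
  oplus a b := fun i => (C i).oplus (a i) (b i)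
  compl a := fun i => (C i).compl (a i)
  smul lam a := fun i => (C i).smul lam (a i)
  seq a b := fun i => (C i).seq (a i) (b i)
  perp_comm := fun a b h i => (C i).perp_comm _ _ (h i)
  oplus_comm := fun a b h => funext fun i => (C i).oplus_comm _ _ (h i)
  perp_assoc_right := fun a b c h1 h2 i => (C i).perp_assoc_right _ _ _ (h1 i) (h2 i)
  perp_assoc_left := fun a b c h1 h2 i => (C i).perp_assoc_left _ _ _ (h1 i) (h2 i)
  oplus_assoc := fun a b c h1 h2 => funext fun i => (C i).oplus_assoc _ _ _ (h1 i) (h2 i)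
  perp_compl := fun a i => (C i).perp_compl _
  oplus_compl := fun a => funext fun i => (C i).oplus_compl _
  compl_unique := fun a b h he =>
    funext fun i => (C i).compl_unique _ _ (h i) (congrFun he i)
  perp_one := fun a h => funext fun i => (C i).perp_one _ (h i)
  smul_smul := fun α β a h1 h2 h3 h4 =>
    funext fun i => (C i).smul_smul _ _ _ h1 h2 h3 h4
  perp_smul_self := fun α β a h1 h2 h3 i => (C i).perp_smul_self _ _ _ h1 h2 h3
  add_smul := fun α β a h1 h2 h3 => funext fun i => (C i).add_smul _ _ _ h1 h2 h3
  perp_smul := fun lam a b h1 h2 h i => (C i).perp_smul _ _ _ h1 h2 (h i)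
  smul_oplus := fun lam a b h1 h2 h =>
    funext fun i => (C i).smul_oplus _ _ _ h1 h2 (h i)
  one_smul := fun a => funext fun i => (C i).one_smul _
  seq_perp := fun a b c h i => (C i).seq_perp _ _ _ (h i)
  seq_oplus := fun a b c h => funext fun i => (C i).seq_oplus _ _ _ (h i)
  one_seq := fun a => funext fun i => (C i).one_seq _
  seq_eq_zero_comm := fun a b h =>
    funext fun i => (C i).seq_eq_zero_comm _ _ (congrFun h i)
  comm_compl := fun a b h => funext fun i => (C i).comm_compl _ _ (congrFun h i)
  comm_assoc := fun a b c h => funext fun i => (C i).comm_assoc _ _ _ (congrFun h i)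
  comm_seq := fun a b c h1 h2 =>
    funext fun i => (C i).comm_seq _ _ _ (congrFun h1 i) (congrFun h2 i)
  comm_oplus := fun a b c h1 h2 hp =>
    funext fun i => (C i).comm_oplus _ _ _ (congrFun h1 i) (congrFun h2 i) (hp i)
  smul_seq := fun lam a b h1 h2 => funext fun i => (C i).smul_seq _ _ _ h1 h2
  seq_smul := fun lam a b h1 h2 => funext fun i => (C i).seq_smul _ _ _ h1 h2

end COSEA
namespace COSEA

variable {E : Type u} (C : COSEA E)

theorem compl_compl (a : E) : C.compl (C.compl a) = a :=
  (C.compl_unique _ _ (C.perp_comm _ _ (C.perp_compl a))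
    ((C.oplus_comm _ _ (C.perp_comm _ _ (C.perp_compl a))).trans (C.oplus_compl a))).symm

theorem compl_one : C.compl C.one = C.zero :=
  C.perp_one _ (C.perp_comm _ _ (C.perp_compl C.one))

theorem compl_zero : C.compl C.zero = C.one := by
  rw [← C.compl_one, C.compl_compl]

theorem one_perp_zero : C.perp C.one C.zero := by
  simpa only [C.compl_one] using C.perp_compl C.one

theorem one_oplus_zero : C.oplus C.one C.zero = C.one := by
  simpa only [C.compl_one] using C.oplus_compl C.one

theorem perp_zero_and_oplus_zero (a : E) : C.perp a C.zero ∧ C.oplus a C.zero = a := by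
  have hp := C.perp_comm _ _ (C.perp_compl a)
  have hs : C.oplus (C.compl a) a = C.one := by
    simpa only [C.compl_compl] using C.oplus_compl (C.compl a)
  have hz : C.perp (C.oplus (C.compl a) a) C.zero := hs ▸ C.one_perp_zero
  refine ⟨C.perp_assoc_right _ _ _ hp hz, ?_⟩
  have h := C.compl_unique _ _ (C.perp_assoc_left _ _ _ hp hz)
    (by rw [C.oplus_assoc _ _ _ hp hz, hs, C.one_oplus_zero])
  rwa [C.compl_compl] at h

theorem eq_zero_of_oplus_self {x : E} (hp : C.perp x x) (h : C.oplus x x = x) :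
    x = C.zero := by
  have hp' : C.perp (C.oplus x x) (C.compl x) := h.symm ▸ C.perp_compl x
  have := C.perp_assoc_left _ _ _ hp hp'
  rw [C.oplus_compl] at this
  exact C.perp_one _ this

theorem eq_zero_of_le_zero {x : E} (h : C.le x C.zero) : x = C.zero := by
  obtain ⟨c, hp, hc⟩ := h
  have h1 : C.perp (C.oplus x c) C.one := hc.symm ▸ C.perp_comm _ _ C.one_perp_zero
  rw [C.perp_one _ (C.perp_assoc_right _ _ _ hp h1), (C.perp_zero_and_oplus_zero x).2] at hc
  exact hc

theorem seq_zero (a : E) : C.seq a C.zero = C.zero := by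
  obtain ⟨hp, hs⟩ := C.perp_zero_and_oplus_zero C.zero
  exact C.eq_zero_of_oplus_self (C.seq_perp a _ _ hp) (by rw [← C.seq_oplus a _ _ hp, hs])

theorem seq_one (a : E) : C.seq a C.one = a := by
  have h := C.comm_compl _ _ (C.seq_eq_zero_comm _ _ (C.seq_zero a)).symm
  rwa [C.compl_zero, C.one_seq] at h

theorem seq_oplus_seq_compl (a b : E) :
    C.oplus (C.seq a b) (C.seq a (C.compl b)) = a := by
  rw [← C.seq_oplus _ _ _ (C.perp_compl b), C.oplus_compl, C.seq_one]

theorem seq_le (a b : E) : C.le (C.seq a b) a :=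
  ⟨_, C.seq_perp _ _ _ (C.perp_compl b), C.seq_oplus_seq_compl a b⟩

theorem seq_mono (a : E) {b c : E} (h : C.le b c) : C.le (C.seq a b) (C.seq a c) := by
  obtain ⟨d, hp, rfl⟩ := h
  exact ⟨_, C.seq_perp _ _ _ hp, (C.seq_oplus _ _ _ hp).symm⟩

variable {C}

theorem IsSharp.seq_self {a : E} (h : C.IsSharp a) : C.seq a a = a := by
  have h0 : C.seq a (C.compl a) = C.zero :=
    C.eq_zero_of_le_zero (h _ (C.seq_le _ _)
      (by rw [C.comm_compl a a rfl]; exact C.seq_le _ _))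
  have := C.seq_oplus_seq_compl a a
  rwa [h0, (C.perp_zero_and_oplus_zero _).2] at this

theorem InOmegaHat.nonneg {ω : E → ℝ} (h : C.InOmegaHat ω) (a : E) : 0 ≤ ω a := by
  rcases h with h | rfl
  · exact (h.1 a).1
  · exact le_rfl

theorem InOmegaHat.map_oplus {ω : E → ℝ} (h : C.InOmegaHat ω) {a b : E} (hp : C.perp a b) :
    ω (C.oplus a b) = ω a + ω b := by
  rcases h with h | rfl
  · exact h.2.2 a b hp
  · simp

theorem InOmegaHat.eq_zero_of_le {ω : E → ℝ} (h : C.InOmegaHat ω) {a b : E}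
    (hab : C.le a b) (hb : ω b = 0) : ω a = 0 := by
  obtain ⟨c, hp, rfl⟩ := hab
  linarith [h.map_oplus hp, h.nonneg a, h.nonneg c]

theorem InOmegaHat.mul_condProb {ω : E → ℝ} (h : C.InOmegaHat ω) (a c : E) :
    ω a * C.condProb a ω c = ω (C.seq a c) := by
  unfold condProb
  split_ifs with h0
  · rw [mul_zero, h.eq_zero_of_le (C.seq_le a c) h0]
  · rw [mul_div_cancel₀ _ h0]

theorem InOmegaHat.mul_condProb_condProb {ω : E → ℝ} (h : C.InOmegaHat ω) (a b c : E) :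
    ω (C.seq a b) * C.condProb b (C.condProb a ω) c = ω (C.seq a (C.seq b c)) := by
  by_cases hab : ω (C.seq a b) = 0
  · rw [hab, zero_mul, h.eq_zero_of_le (C.seq_mono a (C.seq_le b c)) hab]
  · have ha : ω a ≠ 0 := fun ha => hab (h.eq_zero_of_le (C.seq_le a b) ha)
    simp only [condProb, if_neg ha, if_neg (div_ne_zero hab ha)]
    field_simp

theorem IsState.comp_seq {ω : E → ℝ} (h : C.IsState ω) {a : E} (ha : ω a = 1) :
    C.IsState fun c => ω (C.seq a c) :=
  ⟨fun _ => h.1 _, by simp only [C.seq_one, ha], fun b c hp => by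
    simp only [C.seq_oplus _ _ _ hp, h.2.2 _ _ (C.seq_perp _ _ _ hp)]⟩

theorem IsSharp.apply_eq_one_of_condProb_eq {a : E} (ha : C.IsSharp a) {ω : E → ℝ}
    (hfix : C.condProb a ω = ω) (hω : ω ≠ fun _ => 0) : ω a = 1 := by
  have h0 : ω a ≠ 0 := fun h0 => hω (by rw [← hfix]; funext c; simp only [condProb, if_pos h0])
  rw [← congrFun hfix a]
  simp only [condProb, if_neg h0, ha.seq_self, div_self h0]

end COSEA

/-- properties of the conditional probability maps `γ_a`. -/
theorem condProb_properties {E : Type u} (C : COSEA E)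
    (hFD : C.FinDim) (hSp : C.Spectral) :
    -- (i) for one-dimensional a, â is the unique nonzero fixed point of γ_a
    (∀ (a : E) (ω₀ : E → ℝ), C.IsOneDim a → C.IsState ω₀ → ω₀ a = 1 →
      C.condProb a ω₀ = ω₀ ∧
      ∀ ω, C.InOmegaHat ω → C.condProb a ω = ω → ω ≠ (fun _ => 0) → ω = ω₀) ∧
    -- (ii)
    (∀ a b c, C.perp a b → C.seq c a = C.seq a c → C.seq c b = C.seq b c →
      ∀ ω, C.IsState ω →
        ω (C.oplus a b) * C.condProb (C.oplus a b) ω c =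
          ω a * C.condProb a ω c + ω b * C.condProb b ω c) ∧
    -- (iii)
    (∀ a b, C.seq a b = C.seq b a → ∀ ω, C.InOmegaHat ω →
      ω (C.compl a) * C.condProb (C.compl a) ω b =
        ω b - ω a * C.condProb a ω b) ∧
    -- (iv)
    (∀ a b c ω, C.InOmegaHat ω →
      ω (C.seq a b) * C.condProb (C.seq a b) ω c = ω (C.seq (C.seq a b) c) ∧
      ω (C.seq a b) * C.condProb b (C.condProb a ω) c =
        ω (C.seq a (C.seq b c))) := by
  have hat {ω : E → ℝ} (h : C.IsState ω) : C.InOmegaHat ω := Or.inl h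
  refine ⟨fun a ω₀ ha hω₀ h1 => ⟨?_, ?_⟩, fun a b c hp hca hcb ω hω => ?_,
    fun a b hab ω hω => ?_,
    fun a b c ω hω => ⟨hω.mul_condProb _ _, hω.mul_condProb_condProb a b c⟩⟩
  · have h := (hSp.1 a ha).unique ⟨hω₀.comp_seq h1, by rw [ha.1.seq_self, h1]⟩ ⟨hω₀, h1⟩
    funext c
    simpa [COSEA.condProb, h1] using congrFun h c
  · intro ω hω hfix hne
    exact (hSp.1 a ha).unique
      ⟨hω.resolve_right hne, ha.1.apply_eq_one_of_condProb_eq hfix hne⟩ ⟨hω₀, h1⟩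
  · rw [(hat hω).mul_condProb, (hat hω).mul_condProb, (hat hω).mul_condProb,
      ← C.comm_oplus _ _ _ hca hcb hp, C.seq_oplus _ _ _ hp, hca, hcb]
    refine hω.2.2 _ _ ?_
    rw [← hca, ← hcb]
    exact C.seq_perp _ _ _ hp
  · rw [hω.mul_condProb, hω.mul_condProb, hab, ← C.comm_compl b a hab.symm, eq_sub_iff_add_eq',
      ← hω.map_oplus (C.seq_perp _ _ _ (C.perp_compl a)), C.seq_oplus_seq_compl]
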